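/- Assume relations (R1), (R2) and (R3) hold in H. Then for all 1 ≤ i < j ≤ n+1 one has Δ(E_{i,j}^N) = E_{i,j}^N ⊗ 1 + g_{i,j}^N ⊗ E_{i,j}^N + (1 − q⁻¹)^N·Σ_{i<p<j} B(p,j;i,p)^{N(N−1)/2}·(E_{i,p}^N·g_{p,j}^N) ⊗ E_{p,j}^N. (Lemma 'comul-powrootvec' in its bosonized form, Remark 'ochopuntocuatro', formula (boson-deltapow).) -/

import Mathlib

open TensorProduct

/-- `B(i,j;p,r) = ∏_{i≤ℓ≤j−1} ∏_{p≤h≤r−1} q_{ℓ,h}`. -/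
def Bq {k : Type*} [Field k] (qm : ℕ → ℕ → k) (i j p r : ℕ) : k :=
  ∏ l ∈ Finset.Ico i j, ∏ h ∈ Finset.Ico p r, qm l h

/-- The iterated commutators `E_{i,j}`: `E_{i,i+1} = a_i` and
`E_{i,j} = E_{i,j−1}·E_{j−1,j} − B(i,j−1;j−1,j)·E_{j−1,j}·E_{i,j−1}` for `j − i ≥ 2`. -/
def ee {k R : Type*} [Field k] [Ring R] [Algebra k R]
    (qm : ℕ → ℕ → k) (x : ℕ → R) : ℕ → ℕ → R
  | i, j =>
    if _ : j ≤ i + 1 then x i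
    else
      ee qm x i (j - 1) * ee qm x (j - 1) j
        - Bq qm i (j - 1) (j - 1) j • (ee qm x (j - 1) j * ee qm x i (j - 1))
  termination_by i j => j - i
  decreasing_by all_goals omega

/-- `g_{i,j} := g_i·g_{i+1}·⋯·g_{j−1}`. -/
def gp {H : Type*} [Monoid H] (g : ℕ → H) (i j : ℕ) : H :=
  (((List.range (j - i)).map fun t => g (i + t))).prod

/-- `X` and `Y` commute up to the scalar `c`: `X * Y = c • (Y * X)`. -/
def QComm {k R : Type*} [Field k] [Ring R] [Algebra k R] (c : k) (X Y : R) : Prop :=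
  X * Y = c • (Y * X)

namespace QComm

variable {k R S : Type*} [Field k] [Ring R] [Algebra k R] [Ring S] [Algebra k S]
variable {b c d : k} {X Y Z W : R}

theorem one_left (X : R) : QComm (1 : k) 1 X := by simp [QComm]

theorem one_right (X : R) : QComm (1 : k) X 1 := by simp [QComm]

theorem symm (h : QComm c X Y) (hcd : c * d = 1) : QComm d Y X := by
  unfold QComm at *
  rw [h, smul_smul, mul_comm d c, hcd, one_smul]

theorem mul_left (h₁ : QComm c X Z) (h₂ : QComm d Y Z) : QComm (c * d) (X * Y) Z := by
  unfold QComm at *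
  rw [mul_assoc, h₂, mul_smul_comm, ← mul_assoc, h₁, smul_mul_assoc, smul_smul, mul_assoc,
    mul_comm d]

theorem mul_right (h₁ : QComm c X Y) (h₂ : QComm d X Z) : QComm (c * d) X (Y * Z) := by
  unfold QComm at *
  rw [← mul_assoc, h₁, smul_mul_assoc, mul_assoc, h₂, mul_smul_comm, smul_smul, mul_assoc]

theorem smul_left (h : QComm c X Y) (s : k) : QComm c (s • X) Y := by
  unfold QComm at *
  rw [smul_mul_assoc, h, mul_smul_comm, smul_comm]

theorem smul_right (h : QComm c X Y) (s : k) : QComm c X (s • Y) := by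
  unfold QComm at *
  rw [smul_mul_assoc, mul_smul_comm, h, smul_comm]

theorem sub_left (h₁ : QComm c X Z) (h₂ : QComm c Y Z) : QComm c (X - Y) Z := by
  unfold QComm at *
  rw [sub_mul, mul_sub, h₁, h₂, smul_sub]

theorem sub_right (h₁ : QComm c X Y) (h₂ : QComm c X Z) : QComm c X (Y - Z) := by
  unfold QComm at *
  rw [sub_mul, mul_sub, h₁, h₂, smul_sub]

theorem sum_left {ι : Type*} {s : Finset ι} {f : ι → R} (h : ∀ p ∈ s, QComm c (f p) X) :
    QComm c (∑ p ∈ s, f p) X := by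
  unfold QComm at *
  rw [Finset.mul_sum, Finset.sum_mul, Finset.smul_sum]
  exact Finset.sum_congr rfl h

theorem commutator_left (h₁ : QComm c X Z) (h₂ : QComm d Y Z) (s : k) :
    QComm (c * d) (X * Y - s • (Y * X)) Z :=
  (h₁.mul_left h₂).sub_left ((mul_comm c d ▸ h₂.mul_left h₁).smul_left s)

theorem commutator_right (h₁ : QComm c X Y) (h₂ : QComm d X Z) (s : k) :
    QComm (c * d) X (Y * Z - s • (Z * Y)) :=
  (h₁.mul_right h₂).sub_right ((mul_comm c d ▸ h₂.mul_right h₁).smul_right s)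

theorem tmul {X' Y' : S} (h : QComm c X Y) (h' : QComm d X' Y') :
    QComm (c * d) (X ⊗ₜ[k] X') (Y ⊗ₜ[k] Y') := by
  unfold QComm at *
  rw [Algebra.TensorProduct.tmul_mul_tmul, Algebra.TensorProduct.tmul_mul_tmul, h, h',
    TensorProduct.smul_tmul_smul]

theorem pow_left (h : QComm c X Y) (m : ℕ) : QComm (c ^ m) (X ^ m) Y := by
  induction m with
  | zero => simpa using one_left Y
  | succ m ih => simpa [pow_succ] using ih.mul_left h

theorem pow_right (h : QComm c X Y) (m : ℕ) : QComm (c ^ m) X (Y ^ m) := by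
  induction m with
  | zero => simpa using one_right X
  | succ m ih => simpa [pow_succ] using ih.mul_right h

theorem mul_pow (h : QComm c Y X) (m : ℕ) :
    (X * Y) ^ m = c ^ (m * (m - 1) / 2) • (X ^ m * Y ^ m) := by
  induction m with
  | zero => simp
  | succ m ih =>
    have hp : Y ^ m * X = c ^ m • (X * Y ^ m) := h.pow_left m
    rw [pow_succ, ih, Nat.triangle_succ, pow_add, ← smul_smul, smul_mul_assoc]
    congr 1
    rw [mul_assoc, ← mul_assoc (Y ^ m), hp, smul_mul_assoc, mul_smul_comm, pow_succ X, pow_succ Y]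
    simp only [mul_assoc]

/-- The braided Jacobi identity when the outer two elements `c`-commute. -/
theorem commutator_assoc (h : QComm c X Z) :
    (X * Y - b • (Y * X)) * Z - (c * d) • (Z * (X * Y - b • (Y * X))) =
      X * (Y * Z - d • (Z * Y)) - (b * c) • ((Y * Z - d • (Z * Y)) * X) := by
  have h' : ∀ T, X * (Z * T) = c • (Z * (X * T)) := fun T => by
    rw [← mul_assoc, h, smul_mul_assoc, mul_assoc]
  have h'' : X * Z = c • (Z * X) := h
  simp only [mul_sub, sub_mul, mul_smul_comm, smul_mul_assoc, mul_assoc, h', h'']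
  module

/-- In type `A₃` the quantum Serre relations force the highest root vector to commute up to a
scalar with the middle generator, provided `q ≠ -1`. -/
theorem highest_middle {x y z : R} {q a b c b' : k} (hq : q + 1 ≠ 0) (hb : b * b' = q⁻¹)
    (hq0 : q ≠ 0) (hxz : QComm c x z)
    (hu : QComm (a * q) (x * y - a • (y * x)) y)
    (hv : QComm (q * b) y (y * z - b • (z * y))) :
    QComm (a * q * b')
      ((x * y - a • (y * x)) * z - (c * b) • (z * (x * y - a • (y * x)))) y := by
  have hb0 : b ≠ 0 := by
    rintro rfl
    exact inv_ne_zero hq0 (by rw [← hb, zero_mul])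
  have hw := commutator_assoc (Y := y) (b := a) (d := b) hxz
  set w := (x * y - a • (y * x)) * z - (c * b) • (z * (x * y - a • (y * x))) with hw₁
  set u := x * y - a • (y * x) with hu₁
  set v := y * z - b • (z * y) with hv₁
  have huz : u * z = w + (c * b) • (z * u) := by rw [hw₁]; abel
  have hxv : x * v = w + (a * c) • (v * x) := by rw [hw]; abel
  clear_value w u v
  unfold QComm at hu hv ⊢
  have e₁ : u * v = (a * q) • (y * w) - b • (w * y) + (a * q * c * b) • (v * u) := by
    have l₁ : u * (y * z) = (a * q) • (y * w) + (a * q * c * b) • (y * (z * u)) := by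
      rw [← mul_assoc, hu, smul_mul_assoc, mul_assoc, huz, mul_add, mul_smul_comm]
      module
    have l₂ : u * (z * y) = w * y + (c * b * a * q) • (z * (y * u)) := by
      rw [← mul_assoc, huz, add_mul, smul_mul_assoc, mul_assoc z, hu, mul_smul_comm]
      module
    rw [hv₁, mul_sub, mul_smul_comm, l₁, l₂, sub_mul, smul_mul_assoc, mul_assoc y z u,
      mul_assoc z y u]
    module
  have e₂ : u * v = (q * b) • (w * y) - a • (y * w) + (a * q * c * b) • (v * u) := by
    have l₁ : x * (y * v) = (q * b) • (w * y) + (q * b * a * c) • (v * (x * y)) := by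
      rw [hv, mul_smul_comm, ← mul_assoc, hxv, add_mul, smul_mul_assoc, mul_assoc]
      module
    have l₂ : y * (x * v) = y * w + (a * c * q * b) • (v * (y * x)) := by
      rw [hxv, mul_add, mul_smul_comm, ← mul_assoc, hv, smul_mul_assoc, mul_assoc]
      module
    rw [hu₁, sub_mul, smul_mul_assoc, mul_assoc x y v, mul_assoc y x v, l₁, l₂, mul_sub,
      mul_smul_comm]
    module
  have e₃ : ((q + 1) * b) • (w * y) = ((q + 1) * b) • ((a * q * b') • (y * w)) := by
    have hs : (q + 1) * b * (a * q * b') = (q + 1) * a := by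
      rw [show (q + 1) * b * (a * q * b') = (q + 1) * a * (q * (b * b')) by ring, hb,
        mul_inv_cancel₀ hq0, mul_one]
    rw [smul_smul, hs]
    have e₄ := sub_eq_zero.2 (e₁.symm.trans e₂)
    rw [← sub_eq_zero, ← neg_eq_zero, ← e₄]
    module
  exact smul_right_injective R (mul_ne_zero hq hb0) e₃

end QComm

/-- The Gaussian binomial coefficient, as a function of the two lower entries `a` and `b` of
`(a + b)! / (a! b!)`. -/
def gaussCoeff {k : Type*} [Field k] (q : k) : ℕ → ℕ → k
  | 0, _ => 1
  | _ + 1, 0 => 1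
  | a + 1, b + 1 => gaussCoeff q a (b + 1) + q ^ (a + 1) * gaussCoeff q (a + 1) b

theorem gaussCoeff_zero_right {k : Type*} [Field k] (q : k) (a : ℕ) :
    gaussCoeff q a 0 = 1 := by
  cases a <;> simp [gaussCoeff]

theorem gaussCoeff_mul {k : Type*} [Field k] (q : k) (a b : ℕ) :
    gaussCoeff q a b * (∏ t ∈ Finset.range a, (1 - q ^ (t + 1))) *
      (∏ t ∈ Finset.range b, (1 - q ^ (t + 1))) =
        ∏ t ∈ Finset.range (a + b), (1 - q ^ (t + 1)) := by
  induction a generalizing b with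
  | zero => simp [gaussCoeff]
  | succ a iha =>
    induction b with
    | zero => simp [gaussCoeff]
    | succ b ihb =>
      have h₁ := iha (b + 1)
      rw [show a + (b + 1) = a + 1 + b by ring] at h₁
      rw [← add_assoc, Finset.prod_range_succ _ (a + 1 + b), gaussCoeff]
      rw [Finset.prod_range_succ _ a] at ihb ⊢
      rw [Finset.prod_range_succ _ b] at h₁ ⊢
      linear_combination (1 - q ^ (a + 1)) * h₁ + q ^ (a + 1) * (1 - q ^ (b + 1)) * ihb

theorem IsPrimitiveRoot.gaussCoeff_eq_zero {k : Type*} [Field k] {q : k} {a b : ℕ}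
    (hq : IsPrimitiveRoot q (a + b)) (ha : a ≠ 0) (hb : b ≠ 0) : gaussCoeff q a b = 0 := by
  have hprod : ∀ m < a + b, ∏ t ∈ Finset.range m, (1 - q ^ (t + 1)) ≠ 0 := fun m hm =>
    Finset.prod_ne_zero_iff.2 fun t ht => sub_ne_zero.2
      (hq.pow_ne_one_of_pos_of_lt (by omega) (by have := Finset.mem_range.1 ht; omega)).symm
  have hzero : ∏ t ∈ Finset.range (a + b), (1 - q ^ (t + 1)) = 0 :=
    Finset.prod_eq_zero (i := a + b - 1) (Finset.mem_range.2 (by omega))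
      (by rw [Nat.sub_add_cancel (by omega), hq.pow_eq_one, sub_self])
  have h := gaussCoeff_mul q a b
  rw [hzero, mul_eq_zero, mul_eq_zero] at h
  exact (h.resolve_right (hprod b (by omega))).resolve_right (hprod a (by omega))

namespace QComm

variable {k R : Type*} [Field k] [Ring R] [Algebra k R] {q : k} {X Y : R}

/-- The `q`-binomial theorem. -/
theorem add_pow (h : QComm q X Y) (m : ℕ) :
    (X + Y) ^ m = ∑ c ∈ Finset.HasAntidiagonal.antidiagonal m, gaussCoeff q c.1 c.2 • (Y ^ c.1 * X ^ c.2) := by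
  induction m with
  | zero => simp [gaussCoeff]
  | succ m ih =>
    have hX : ∀ a b, X * (Y ^ a * X ^ b) = q ^ a • (Y ^ a * X ^ (b + 1)) := fun a b => by
      have := h.pow_right a
      unfold QComm at this
      rw [← mul_assoc, this, smul_mul_assoc, mul_assoc, ← pow_succ']
    have hY : ∀ a b, Y * (Y ^ a * X ^ b) = Y ^ (a + 1) * X ^ b := fun a b => by
      rw [← mul_assoc, ← pow_succ']
    rw [pow_succ', ih, add_mul, Finset.mul_sum, Finset.mul_sum]
    simp only [mul_smul_comm, hX, hY]
    cases m with
    | zero => simp [gaussCoeff, Finset.Nat.antidiagonal_succ]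
    | succ m =>
      rw [Finset.Nat.antidiagonal_succ_succ', Finset.Nat.sum_antidiagonal_succ,
        Finset.Nat.sum_antidiagonal_succ']
      simp [gaussCoeff, gaussCoeff_zero_right, add_smul, Finset.sum_add_distrib, smul_smul,
        mul_comm]
      abel

theorem add_pow_of_isPrimitiveRoot {N : ℕ} (h : QComm q X Y) (hq : IsPrimitiveRoot q N)
    (hN : 1 < N) : (X + Y) ^ N = X ^ N + Y ^ N := by
  rw [h.add_pow, Finset.sum_eq_add_of_mem (0, N) (N, 0) (by simp) (by simp)
    (by simp; omega)]
  · simp [gaussCoeff, gaussCoeff_zero_right]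
  · rintro ⟨a, b⟩ hab ⟨h₁, h₂⟩
    obtain rfl := Finset.HasAntidiagonal.mem_antidiagonal.1 hab
    dsimp only at *
    rw [hq.gaussCoeff_eq_zero (by rintro rfl; simp at h₁) (by rintro rfl; simp at h₂), zero_smul]

theorem sum_pow_of_isPrimitiveRoot {N : ℕ} (hq : IsPrimitiveRoot q N) (hN : 1 < N)
    (s : Finset ℕ) (f : ℕ → R) (h : ∀ p ∈ s, ∀ r ∈ s, p < r → QComm q (f p) (f r)) :
    (∑ p ∈ s, f p) ^ N = ∑ p ∈ s, f p ^ N := by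
  induction s using Finset.induction_on_max with
  | empty => simp [show N ≠ 0 by omega]
  | insert r s hr ih =>
    have hrs : r ∉ s := fun hm => lt_irrefl r (hr r hm)
    rw [Finset.sum_insert hrs, Finset.sum_insert hrs, add_comm,
      add_pow_of_isPrimitiveRoot (q := q) _ hq hN, ih, add_comm]
    · exact fun p hp t ht => h p (Finset.mem_insert_of_mem hp) t (Finset.mem_insert_of_mem ht)
    · exact sum_left fun p hp =>
        h p (Finset.mem_insert_of_mem hp) r (Finset.mem_insert_self r s) (hr p hp)

end QComm

section Bq

variable {k : Type*} [Field k] (qm : ℕ → ℕ → k)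

@[simp] theorem Bq_self_left (i p r : ℕ) : Bq qm i i p r = 1 := by simp [Bq]

@[simp] theorem Bq_self_right (i j p : ℕ) : Bq qm i j p p = 1 := by simp [Bq]

theorem Bq_mul_left {i m j : ℕ} (him : i ≤ m) (hmj : m ≤ j) (p r : ℕ) :
    Bq qm i m p r * Bq qm m j p r = Bq qm i j p r :=
  Finset.prod_Ico_consecutive _ him hmj

theorem Bq_mul_right {p m r : ℕ} (i j : ℕ) (hpm : p ≤ m) (hmr : m ≤ r) :
    Bq qm i j p m * Bq qm i j m r = Bq qm i j p r := by
  simp only [Bq, ← Finset.prod_mul_distrib, Finset.prod_Ico_consecutive _ hpm hmr]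

theorem Bq_succ_succ (i j : ℕ) : Bq qm i (i + 1) j (j + 1) = qm i j := by simp [Bq]

theorem prod_Bq_left (i j p r : ℕ) :
    ∏ m ∈ Finset.Ico i j, Bq qm m (m + 1) p r = Bq qm i j p r := by simp [Bq]

theorem prod_Bq_right (i j p r : ℕ) :
    ∏ m ∈ Finset.Ico p r, Bq qm i j m (m + 1) = Bq qm i j p r := by
  simp only [Bq, Nat.Ico_succ_singleton, Finset.prod_singleton]
  exact Finset.prod_comm

/-- The braiding matrix is of Cartan type `A_n` with parameter `q`. -/
structure IsTypeA (n : ℕ) (q : k) : Prop where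
  ne_zero : q ≠ 0
  diag : ∀ i, 1 ≤ i → i ≤ n → qm i i = q
  adj : ∀ i, 1 ≤ i → i + 1 ≤ n → qm i (i + 1) * qm (i + 1) i = q⁻¹
  far : ∀ i j, 1 ≤ i → i + 2 ≤ j → j ≤ n → qm i j * qm j i = 1

variable {qm} {n : ℕ} {q : k}

namespace IsTypeA

theorem Bq_far (hA : IsTypeA qm n q) {i j p r : ℕ} (hi : 1 ≤ i) (hjp : j < p) (hr : r ≤ n + 1) :
    Bq qm i j p r * Bq qm p r i j = 1 := by
  rw [Bq, Bq, Finset.prod_comm (s := Finset.Ico p r), ← Finset.prod_mul_distrib]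
  refine Finset.prod_eq_one fun l hl => ?_
  rw [← Finset.prod_mul_distrib]
  refine Finset.prod_eq_one fun h hh => ?_
  rw [Finset.mem_Ico] at hl hh
  exact hA.far l h (by omega) (by omega) (by omega)

theorem Bq_adj (hA : IsTypeA qm n q) {i m j : ℕ} (hi : 1 ≤ i) (him : i < m) (hmj : m < j)
    (hj : j ≤ n + 1) : Bq qm i m m j * Bq qm m j i m = q⁻¹ := by
  obtain ⟨m, rfl⟩ : ∃ t, m = t + 1 := ⟨m - 1, by omega⟩
  have h₁ := hA.Bq_far hi (lt_add_one m) hj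
  have h₂ := hA.Bq_far (i := m) (j := m + 1) (p := m + 1 + 1) (r := j) (by omega) (by omega) hj
  have h₃ := hA.adj m (by omega) (by omega)
  rw [← Bq_succ_succ qm m, ← Bq_succ_succ qm (m + 1)] at h₃
  rw [← Bq_mul_left qm (show i ≤ m by omega) (show m ≤ m + 1 by omega),
    ← Bq_mul_right qm _ _ (show i ≤ m by omega) (show m ≤ m + 1 by omega),
    ← Bq_mul_right qm m _ (show m + 1 ≤ m + 1 + 1 by omega) (show m + 1 + 1 ≤ j by omega),
    ← Bq_mul_left qm (show m + 1 ≤ m + 1 + 1 by omega) (show m + 1 + 1 ≤ j by omega) m (m + 1)]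
  calc _ = (Bq qm i m (m + 1) j * Bq qm (m + 1) j i m) *
        (Bq qm m (m + 1) (m + 1 + 1) j * Bq qm (m + 1 + 1) j m (m + 1)) *
        (Bq qm m (m + 1) (m + 1) (m + 1 + 1) * Bq qm (m + 1) (m + 1 + 1) m (m + 1)) := by ring
    _ = q⁻¹ := by rw [h₁, h₂, h₃, one_mul, one_mul]

theorem Bq_diag (hA : IsTypeA qm n q) {i j : ℕ} (hi : 1 ≤ i) (hij : i < j) (hj : j ≤ n + 1) :
    Bq qm i j i j = q := by
  induction j, hij using Nat.le_induction with
  | base => rw [Bq_succ_succ, hA.diag i hi (by omega)]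
  | succ j hij ih =>
    have hij : i < j := hij
    have h₁ := ih (by omega)
    have h₂ := hA.Bq_adj hi hij (lt_add_one j) hj
    have h₃ : Bq qm j (j + 1) j (j + 1) = q := by
      rw [Bq_succ_succ, hA.diag j (by omega) (by omega)]
    rw [← Bq_mul_left qm hij.le (Nat.le_succ j), ← Bq_mul_right qm i j hij.le (Nat.le_succ j),
      ← Bq_mul_right qm j _ hij.le (Nat.le_succ j)]
    calc _ = Bq qm i j i j * (Bq qm i j j (j + 1) * Bq qm j (j + 1) i j) *
          Bq qm j (j + 1) j (j + 1) := by ring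
      _ = q := by rw [h₁, h₂, h₃, mul_inv_cancel₀ hA.ne_zero, one_mul]

theorem Bq_interior (hA : IsTypeA qm n q) {i m j : ℕ} (hi : 1 ≤ i) (him : i < m)
    (hmj : m + 1 < j) (hj : j ≤ n + 1) : Bq qm i j m (m + 1) * Bq qm m (m + 1) i j = 1 := by
  have h₁ := hA.Bq_adj hi him (lt_add_one m) (by omega)
  have h₂ := hA.Bq_adj (show 1 ≤ m by omega) (lt_add_one m) hmj hj
  have h₃ := hA.Bq_diag (show 1 ≤ m by omega) (lt_add_one m) (by omega)
  rw [← Bq_mul_left qm him.le (show m ≤ j by omega),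
    ← Bq_mul_left qm (Nat.le_succ m) hmj.le,
    ← Bq_mul_right qm _ _ him.le (show m ≤ j by omega),
    ← Bq_mul_right qm _ _ (Nat.le_succ m) hmj.le, Nat.succ_eq_add_one, h₃]
  calc _ = (Bq qm i m m (m + 1) * Bq qm m (m + 1) i m) * q * q *
        (Bq qm m (m + 1) (m + 1) j * Bq qm (m + 1) j m (m + 1)) := by ring
    _ = 1 := by
      rw [h₁, h₂, inv_mul_cancel₀ hA.ne_zero, one_mul, mul_inv_cancel₀ hA.ne_zero]

end IsTypeA

end Bq

section RootVectors

variable {k R : Type*} [Field k] [Ring R] [Algebra k R] {qm : ℕ → ℕ → k} {x : ℕ → R}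

theorem ee_succ_self (i : ℕ) : ee qm x i (i + 1) = x i := by
  rw [ee, dif_pos le_rfl]

theorem ee_succ {i j : ℕ} (hij : i < j) :
    ee qm x i (j + 1) = ee qm x i j * ee qm x j (j + 1)
      - Bq qm i j j (j + 1) • (ee qm x j (j + 1) * ee qm x i j) := by
  rw [ee, dif_neg (by omega), Nat.add_sub_cancel]

theorem QComm.ee_left {i j : ℕ} {Z : R} {d : ℕ → k} (hij : i < j)
    (h : ∀ m, i ≤ m → m < j → QComm (d m) (x m) Z) :
    QComm (∏ m ∈ Finset.Ico i j, d m) (ee qm x i j) Z := by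
  induction j, hij using Nat.le_induction with
  | base => simpa [ee_succ_self] using h i le_rfl (lt_add_one i)
  | succ j hij ih =>
    rw [ee_succ hij, Finset.prod_Ico_succ_top (Nat.le_of_succ_le hij), ee_succ_self]
    exact (ih fun m h₁ h₂ => h m h₁ (by omega)).commutator_left
      (h j (Nat.le_of_succ_le hij) (lt_add_one j)) _

theorem QComm.ee_right {i j : ℕ} {Z : R} {d : ℕ → k} (hij : i < j)
    (h : ∀ m, i ≤ m → m < j → QComm (d m) Z (x m)) :
    QComm (∏ m ∈ Finset.Ico i j, d m) Z (ee qm x i j) := by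
  induction j, hij using Nat.le_induction with
  | base => simpa [ee_succ_self] using h i le_rfl (lt_add_one i)
  | succ j hij ih =>
    rw [ee_succ hij, Finset.prod_Ico_succ_top (Nat.le_of_succ_le hij), ee_succ_self]
    exact (ih fun m h₁ h₂ => h m h₁ (by omega)).commutator_right
      (h j (Nat.le_of_succ_le hij) (lt_add_one j)) _

variable (qm x) in
/-- The quantum Serre relations of type `A_n` for the generators `x 1, …, x n`. -/
structure QSerre (n : ℕ) : Prop where
  far : ∀ i p, 1 ≤ i → i + 2 ≤ p → p ≤ n → QComm (qm i p) (x i) (x p)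
  left : ∀ i, 1 ≤ i → i < n →
    QComm (Bq qm i (i + 1) i (i + 2)) (ee qm x i (i + 1)) (ee qm x i (i + 2))
  right : ∀ i, 1 ≤ i → i < n →
    QComm (Bq qm i (i + 2) (i + 1) (i + 2)) (ee qm x i (i + 2)) (ee qm x (i + 1) (i + 2))

namespace QSerre

variable {n : ℕ} {q : k}

theorem qcomm_far (hS : QSerre qm x n) {i j p r : ℕ} (hi : 1 ≤ i) (hij : i < j) (hjp : j < p)
    (hpr : p < r) (hr : r ≤ n + 1) : QComm (Bq qm i j p r) (ee qm x i j) (ee qm x p r) := by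
  rw [← prod_Bq_left]
  refine QComm.ee_left hij fun l hl₁ hl₂ => ?_
  rw [← prod_Bq_right]
  refine QComm.ee_right hpr fun h hh₁ hh₂ => ?_
  rw [Bq_succ_succ]
  exact hS.far l h (by omega) (by omega) (by omega)

theorem qcomm_far' (hS : QSerre qm x n) (hA : IsTypeA qm n q) {i j p r : ℕ} (hi : 1 ≤ i)
    (hij : i < j) (hjp : j < p) (hpr : p < r) (hr : r ≤ n + 1) :
    QComm (Bq qm p r i j) (ee qm x p r) (ee qm x i j) :=
  (hS.qcomm_far hi hij hjp hpr hr).symm (hA.Bq_far hi hjp hr)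

/-- A root vector is the braided commutator of any two root vectors it splits into. -/
theorem ee_eq (hS : QSerre qm x n) {i j l : ℕ} (hi : 1 ≤ i) (hij : i < j) (hjl : j < l)
    (hl : l ≤ n + 1) :
    ee qm x i l = ee qm x i j * ee qm x j l - Bq qm i j j l • (ee qm x j l * ee qm x i j) := by
  induction l, hjl using Nat.le_induction with
  | base => exact ee_succ hij
  | succ l hjl ih =>
    have hjl : j < l := hjl
    rw [ee_succ (hij.trans hjl), ih (by omega), ee_succ hjl,
      ← Bq_mul_left qm hij.le hjl.le l (l + 1), ← Bq_mul_right qm i j hjl.le (Nat.le_succ l)]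
    exact (hS.qcomm_far hi hij hjl (lt_add_one l) hl).commutator_assoc

theorem qcomm_first (hS : QSerre qm x n) {i j : ℕ} (hi : 1 ≤ i) (hij : i + 1 < j)
    (hj : j ≤ n + 1) : QComm (Bq qm i (i + 1) i j) (ee qm x i (i + 1)) (ee qm x i j) := by
  obtain rfl | hij' := eq_or_lt_of_le (show i + 2 ≤ j from hij)
  · exact hS.left i hi (by omega)
  · rw [hS.ee_eq hi (show i < i + 2 by omega) hij' hj,
      ← Bq_mul_right qm i (i + 1) (show i ≤ i + 2 by omega) hij'.le]
    exact (hS.left i hi (by omega)).commutator_right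
      (hS.qcomm_far hi (by omega) (by omega) hij' hj) _

theorem qcomm_last (hS : QSerre qm x n) {i j : ℕ} (hi : 1 ≤ i) (hij : i < j)
    (hj : j ≤ n) : QComm (Bq qm i (j + 1) j (j + 1)) (ee qm x i (j + 1)) (ee qm x j (j + 1)) := by
  obtain ⟨j, rfl⟩ : ∃ t, j = t + 1 := ⟨j - 1, by omega⟩
  obtain rfl | hij' := eq_or_lt_of_le (show i ≤ j by omega)
  · exact hS.right i hi (by omega)
  · rw [hS.ee_eq hi hij' (show j < j + 2 by omega) (by omega),
      ← Bq_mul_left qm hij'.le (show j ≤ j + 2 by omega)]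
    exact (hS.qcomm_far hi hij' (by omega) (by omega) (by omega)).commutator_left
      (hS.right j (by omega) (by omega)) _

theorem qcomm_middle (hS : QSerre qm x n) (hA : IsTypeA qm n q) (hq : q + 1 ≠ 0) {i : ℕ}
    (hi : 1 ≤ i) (hn : i + 2 ≤ n) :
    QComm (Bq qm i (i + 3) (i + 1) (i + 2)) (ee qm x i (i + 3)) (ee qm x (i + 1) (i + 2)) := by
  have h₁ := hS.qcomm_far (i := i) (j := i + 1) (p := i + 2) (r := i + 3) hi (by omega) (by omega)
    (by omega) (by omega)
  have hd := hA.diag (i + 1) (by omega) (by omega)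
  have hu := hS.right i hi (by omega)
  have hv := hS.left (i + 1) (by omega) (by omega)
  have e₁ := ee_succ (qm := qm) (x := x) (show i < i + 1 by omega)
  have e₂ := ee_succ (qm := qm) (x := x) (show i + 1 < i + 2 by omega)
  have e₃ := ee_succ (qm := qm) (x := x) (show i < i + 2 by omega)
  have b₁ : Bq qm i (i + 2) (i + 1) (i + 2) = qm i (i + 1) * q := by
    rw [← Bq_mul_left qm (show i ≤ i + 1 by omega) (show i + 1 ≤ i + 2 by omega),
      Bq_succ_succ, Bq_succ_succ, hd]
  have b₂ : Bq qm (i + 1) (i + 2) (i + 1) (i + 3) = q * qm (i + 1) (i + 2) := by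
    rw [← Bq_mul_right qm _ _ (show i + 1 ≤ i + 2 by omega) (show i + 2 ≤ i + 3 by omega),
      Bq_succ_succ, Bq_succ_succ, hd]
  have b₃ : Bq qm i (i + 3) (i + 1) (i + 2) = qm i (i + 1) * q * qm (i + 2) (i + 1) := by
    rw [← Bq_mul_left qm (show i ≤ i + 2 by omega) (show i + 2 ≤ i + 3 by omega), b₁,
      Bq_succ_succ]
  have b₄ : Bq qm i (i + 2) (i + 2) (i + 3) = qm i (i + 2) * qm (i + 1) (i + 2) := by
    rw [← Bq_mul_left qm (show i ≤ i + 1 by omega) (show i + 1 ≤ i + 2 by omega),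
      Bq_succ_succ, Bq_succ_succ]
  rw [b₁, e₁] at hu
  rw [b₂, e₂] at hv
  rw [e₃, e₁, b₃, b₄]
  rw [Bq_succ_succ] at hu hv h₁ ⊢
  exact QComm.highest_middle hq (hA.adj (i + 1) (by omega) (by omega)) hA.ne_zero h₁ hu hv

theorem qcomm_interior (hS : QSerre qm x n) (hA : IsTypeA qm n q) (hq : q + 1 ≠ 0) {i m j : ℕ}
    (hi : 1 ≤ i) (him : i < m) (hmj : m + 1 < j) (hj : j ≤ n + 1) :
    QComm (Bq qm i j m (m + 1)) (ee qm x i j) (ee qm x m (m + 1)) := by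
  obtain ⟨m, rfl⟩ : ∃ t, m = t + 1 := ⟨m - 1, by omega⟩
  have h₁ : QComm (Bq qm m j (m + 1) (m + 2)) (ee qm x m j) (ee qm x (m + 1) (m + 2)) := by
    obtain rfl | hmj' := eq_or_lt_of_le (show m + 3 ≤ j from hmj)
    · exact hS.qcomm_middle hA hq (by omega) (by omega)
    · rw [hS.ee_eq (by omega) (show m < m + 3 by omega) hmj' hj,
        ← Bq_mul_left qm (show m ≤ m + 3 by omega) hmj'.le]
      exact (hS.qcomm_middle hA hq (by omega) (by omega)).commutator_left
        (hS.qcomm_far' hA (by omega) (by omega) (by omega) hmj' hj) _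
  obtain rfl | him' := eq_or_lt_of_le (show i ≤ m by omega)
  · exact h₁
  · rw [hS.ee_eq hi him' (by omega) hj, ← Bq_mul_left qm him'.le (show m ≤ j by omega)]
    exact (hS.qcomm_far hi him' (by omega) (by omega) (by omega)).commutator_left h₁ _

theorem qcomm_common_left (hS : QSerre qm x n) (hA : IsTypeA qm n q) (hq : q + 1 ≠ 0)
    {i p r : ℕ} (hi : 1 ≤ i) (hip : i < p) (hpr : p < r) (hr : r ≤ n + 1) :
    QComm (Bq qm i p i r) (ee qm x i p) (ee qm x i r) := by
  rw [← prod_Bq_left]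
  refine QComm.ee_left hip fun m hm₁ hm₂ => ?_
  rw [← ee_succ_self (qm := qm) (x := x) m]
  obtain rfl | hm := eq_or_lt_of_le hm₁
  · exact hS.qcomm_first hi (by omega) hr
  · refine (hS.qcomm_interior hA hq hi hm (by omega) hr).symm ?_
    exact hA.Bq_interior hi hm (by omega) hr

theorem qcomm_common_right (hS : QSerre qm x n) (hA : IsTypeA qm n q) (hq : q + 1 ≠ 0)
    {p r j : ℕ} (hp : 1 ≤ p) (hpr : p < r) (hrj : r < j) (hj : j ≤ n + 1) :
    QComm (Bq qm p j r j) (ee qm x p j) (ee qm x r j) := by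
  rw [← prod_Bq_right]
  refine QComm.ee_right hrj fun m hm₁ hm₂ => ?_
  rw [← ee_succ_self (qm := qm) (x := x) m]
  obtain rfl | hm := eq_or_lt_of_le (show m + 1 ≤ j from hm₂)
  · exact hS.qcomm_last hp (by omega) (by omega)
  · exact hS.qcomm_interior hA hq hp (by omega) hm hj

end QSerre

end RootVectors

section GroupLike

variable {M : Type*} [Monoid M] {g : ℕ → M}

@[simp] theorem gp_self (i : ℕ) : gp g i i = 1 := by simp [gp]

theorem gp_succ {i j : ℕ} (hij : i ≤ j) : gp g i (j + 1) = gp g i j * g j := by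
  rw [gp, gp, Nat.succ_sub hij, List.range_succ]
  simp [Nat.add_sub_cancel' hij]

theorem gp_mul {i m j : ℕ} (him : i ≤ m) (hmj : m ≤ j) : gp g i m * gp g m j = gp g i j := by
  induction j, hmj using Nat.le_induction with
  | base => simp
  | succ j hmj ih => rw [gp_succ hmj, gp_succ (him.trans hmj), ← mul_assoc, ih]

theorem gp_commute {i j p r : ℕ} (hij : i ≤ j) (hpr : p ≤ r)
    (h : ∀ l m, i ≤ l → l < j → p ≤ m → m < r → Commute (g l) (g m)) :
    Commute (gp g i j) (gp g p r) := by
  induction j, hij using Nat.le_induction with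
  | base => simp
  | succ j hij ih =>
    rw [gp_succ hij]
    refine (ih fun l m h₁ h₂ => h l m h₁ (by omega)).mul_left ?_
    replace h := h j
    clear ih
    induction r, hpr using Nat.le_induction with
    | base => simp
    | succ r hpr ih =>
      rw [gp_succ hpr]
      exact (ih fun m h₁ h₂ h₃ h₄ => h m h₁ h₂ h₃ (by omega)).mul_right
        (h r hij (lt_add_one j) hpr (lt_add_one r))

end GroupLike

section Coproduct

variable {k H : Type*} [Field k] [Ring H] [Bialgebra k H] {qm : ℕ → ℕ → k}
  {g a : ℕ → H} {n : ℕ} {q : k}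

variable (qm g a n) in
/-- The elements `a 1, …, a n` are skew-primitive with respect to the commuting elements
`g 1, …, g n`, which act on them through the braiding matrix. -/
structure IsSkewPrimitive : Prop where
  comm : ∀ i j, 1 ≤ i → i ≤ n → 1 ≤ j → j ≤ n → Commute (g i) (g j)
  comul_a : ∀ i, 1 ≤ i → i ≤ n →
    Coalgebra.comul (R := k) (a i) = a i ⊗ₜ[k] 1 + g i ⊗ₜ[k] a i
  qcomm : ∀ i j, 1 ≤ i → i ≤ n → 1 ≤ j → j ≤ n → QComm (qm i j) (g i) (a j)

variable (qm a) in
/-- The root vector of the interval `[i, j)`, with the convention that the empty interval has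
root vector `1`. -/
def rootVec (i j : ℕ) : H := if i = j then 1 else ee qm a i j

@[simp] theorem rootVec_self (i : ℕ) : rootVec qm a i i = 1 := if_pos rfl

theorem rootVec_of_lt {i j : ℕ} (hij : i < j) : rootVec qm a i j = ee qm a i j :=
  if_neg hij.ne

namespace IsSkewPrimitive

theorem gp_qcomm_ee (hG : IsSkewPrimitive qm g a n) {p j i r : ℕ} (hp : 1 ≤ p) (hpj : p ≤ j)
    (hj : j ≤ n + 1) (hi : 1 ≤ i) (hir : i < r) (hr : r ≤ n + 1) :
    QComm (Bq qm p j i r) (gp g p j) (ee qm a i r) := by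
  induction j, hpj using Nat.le_induction with
  | base => simpa using QComm.one_left (k := k) (ee qm a i r)
  | succ j hpj ih =>
    rw [gp_succ hpj, ← Bq_mul_left qm hpj (Nat.le_succ j)]
    refine (ih (by omega)).mul_left ?_
    rw [← prod_Bq_right]
    refine QComm.ee_right hir fun m h₁ h₂ => ?_
    rw [Bq_succ_succ]
    exact hG.qcomm j m (by omega) (by omega) (by omega) (by omega)

theorem gp_qcomm_rootVec (hG : IsSkewPrimitive qm g a n) {p j i r : ℕ} (hp : 1 ≤ p)
    (hpj : p ≤ j) (hj : j ≤ n + 1) (hi : 1 ≤ i) (hir : i ≤ r) (hr : r ≤ n + 1) :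
    QComm (Bq qm p j i r) (gp g p j) (rootVec qm a i r) := by
  obtain rfl | hir := hir.eq_or_lt
  · simpa using QComm.one_right (k := k) (gp g p j)
  · rw [rootVec_of_lt hir]
    exact hG.gp_qcomm_ee hp hpj hj hi hir hr

theorem comul_ee (hG : IsSkewPrimitive qm g a n) (hA : IsTypeA qm n q) (hS : QSerre qm a n)
    {i j : ℕ} (hi : 1 ≤ i) (hij : i < j) (hj : j ≤ n + 1) :
    Coalgebra.comul (R := k) (ee qm a i j) =
      ee qm a i j ⊗ₜ[k] 1 + gp g i j ⊗ₜ[k] ee qm a i j +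
        (1 - q⁻¹) • ∑ p ∈ Finset.Ioo i j, (ee qm a i p * gp g p j) ⊗ₜ[k] ee qm a p j := by
  induction j, hij using Nat.le_induction with
  | base =>
    have : Finset.Ioo i (i + 1) = ∅ := by ext; simp
    rw [Nat.succ_eq_add_one, this, ee_succ_self, hG.comul_a i hi (by omega), gp_succ le_rfl]
    simp
  | succ j hij ih =>
    have hij : i < j := hij
    have hIoo : Finset.Ioo i (j + 1) = insert j (Finset.Ioo i j) := by ext; simp; omega
    have hlast : Coalgebra.comul (R := k) (ee qm a j (j + 1)) =
        ee qm a j (j + 1) ⊗ₜ[k] 1 + gp g j (j + 1) ⊗ₜ[k] ee qm a j (j + 1) := by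
      rw [ee_succ_self, gp_succ le_rfl, gp_self, one_mul]
      exact hG.comul_a j (by omega) (by omega)
    have hE : ee qm a i j * gp g j (j + 1) -
        Bq qm i j j (j + 1) • (gp g j (j + 1) * ee qm a i j) =
          (1 - q⁻¹) • (ee qm a i j * gp g j (j + 1)) := by
      have h : gp g j (j + 1) * ee qm a i j = _ :=
        hG.gp_qcomm_ee (by omega) (Nat.le_succ j) hj hi hij (by omega)
      rw [h, smul_smul, hA.Bq_adj hi hij (lt_add_one j) hj, sub_smul, one_smul]
    have hg : gp g i j * ee qm a j (j + 1) =
        Bq qm i j j (j + 1) • (ee qm a j (j + 1) * gp g i j) :=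
      hG.gp_qcomm_ee hi hij.le (by omega) (by omega) (lt_add_one j) hj
    have hgg : gp g j (j + 1) * gp g i j = gp g i (j + 1) := by
      rw [← gp_mul hij.le (Nat.le_succ j)]
      exact gp_commute (Nat.le_succ j) hij.le fun l m _ _ _ _ =>
        hG.comm l m (by omega) (by omega) (by omega) (by omega)
    have hterm : ∀ p ∈ Finset.Ioo i j,
        (ee qm a i p * gp g p j) ⊗ₜ[k] ee qm a p j *
            (ee qm a j (j + 1) ⊗ₜ[k] 1 + gp g j (j + 1) ⊗ₜ[k] ee qm a j (j + 1)) -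
          Bq qm i j j (j + 1) •
            ((ee qm a j (j + 1) ⊗ₜ[k] 1 + gp g j (j + 1) ⊗ₜ[k] ee qm a j (j + 1)) *
              (ee qm a i p * gp g p j) ⊗ₜ[k] ee qm a p j) =
          (ee qm a i p * gp g p (j + 1)) ⊗ₜ[k] ee qm a p (j + 1) := by
      intro p hp
      obtain ⟨hip, hpj⟩ := Finset.mem_Ioo.1 hp
      have h₁ : (ee qm a i p * gp g p j) * ee qm a j (j + 1) =
          Bq qm i j j (j + 1) • (ee qm a j (j + 1) * (ee qm a i p * gp g p j)) := by
        rw [← Bq_mul_left qm hip.le hpj.le]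
        exact (hS.qcomm_far hi hip hpj (lt_add_one j) hj).mul_left
          (hG.gp_qcomm_ee (by omega) hpj.le (by omega) (by omega) (lt_add_one j) hj)
      have h₂ : gp g j (j + 1) * (ee qm a i p * gp g p j) =
          Bq qm j (j + 1) i p • (ee qm a i p * gp g p (j + 1)) := by
        have h : gp g j (j + 1) * ee qm a i p = _ :=
          hG.gp_qcomm_ee (by omega) (Nat.le_succ j) hj hi hip (by omega)
        have h' : gp g j (j + 1) * gp g p j = gp g p (j + 1) := by
          rw [← gp_mul hpj.le (Nat.le_succ j)]
          exact gp_commute (Nat.le_succ j) hpj.le fun l m _ _ _ _ =>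
            hG.comm l m (by omega) (by omega) (by omega) (by omega)
        rw [← mul_assoc, h, smul_mul_assoc, mul_assoc, h']
      have h₃ : Bq qm i j j (j + 1) * Bq qm j (j + 1) i p = Bq qm p j j (j + 1) := by
        rw [← Bq_mul_left qm hip.le hpj.le, mul_right_comm,
          hA.Bq_far hi hpj hj, one_mul]
      have h₄ : ee qm a i p * gp g p j * gp g j (j + 1) = ee qm a i p * gp g p (j + 1) := by
        rw [mul_assoc, gp_mul hpj.le (Nat.le_succ j)]
      rw [mul_add, add_mul]
      simp only [Algebra.TensorProduct.tmul_mul_tmul, mul_one, one_mul]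
      rw [h₁, h₂, h₄, ee_succ hpj, smul_add, TensorProduct.smul_tmul', TensorProduct.smul_tmul',
        smul_smul, h₃, TensorProduct.tmul_sub, TensorProduct.tmul_smul,
        TensorProduct.smul_tmul']
      abel
    have hsum := Finset.sum_congr rfl hterm
    rw [Finset.sum_sub_distrib, ← Finset.smul_sum, ← Finset.sum_mul, ← Finset.mul_sum] at hsum
    rw [hIoo, Finset.sum_insert (by simp), ← hsum, smul_add, TensorProduct.smul_tmul' _ (_ * _),
      ← hE]
    rw [ee_succ hij, map_sub, map_smul, Bialgebra.comul_mul, Bialgebra.comul_mul,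
      ih (by omega), hlast]
    set S := ∑ p ∈ Finset.Ioo i j, (ee qm a i p * gp g p j) ⊗ₜ[k] ee qm a p j
    simp only [add_mul, mul_add, Algebra.TensorProduct.tmul_mul_tmul, mul_one, one_mul, hg, hgg,
      gp_mul hij.le (Nat.le_succ j), TensorProduct.sub_tmul, TensorProduct.tmul_sub,
      TensorProduct.tmul_smul, smul_mul_assoc, mul_smul_comm, ← TensorProduct.smul_tmul']
    module

end IsSkewPrimitive

theorem QSerre.qcomm_rootVec_left (hS : QSerre qm a n) (hA : IsTypeA qm n q) (hq : q + 1 ≠ 0)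
    {i p r : ℕ} (hi : 1 ≤ i) (hip : i ≤ p) (hpr : p < r) (hr : r ≤ n + 1) :
    QComm (Bq qm i p i r) (rootVec qm a i p) (rootVec qm a i r) := by
  obtain rfl | hip := hip.eq_or_lt
  · simpa using QComm.one_left (k := k) (rootVec qm a i r)
  · rw [rootVec_of_lt hip, rootVec_of_lt (hip.trans hpr)]
    exact hS.qcomm_common_left hA hq hi hip hpr hr

theorem QSerre.qcomm_rootVec_right (hS : QSerre qm a n) (hA : IsTypeA qm n q) (hq : q + 1 ≠ 0)
    {p r j : ℕ} (hp : 1 ≤ p) (hpr : p < r) (hrj : r ≤ j) (hj : j ≤ n + 1) :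
    QComm (Bq qm p j r j) (rootVec qm a p j) (rootVec qm a r j) := by
  obtain rfl | hrj := hrj.eq_or_lt
  · simpa using QComm.one_right (k := k) (rootVec qm a p r)
  · rw [rootVec_of_lt hrj, rootVec_of_lt (hpr.trans hrj)]
    exact hS.qcomm_common_right hA hq hp hpr hrj hj

theorem IsTypeA.Bq_summands (hA : IsTypeA qm n q) {i p r j : ℕ} (hi : 1 ≤ i) (hip : i ≤ p)
    (hpr : p < r) (hrj : r ≤ j) (hj : j ≤ n + 1) :
    Bq qm i p i r * Bq qm i p r j * Bq qm p j i r * Bq qm p j r j = q := by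
  have hAB : Bq qm i p i p * (Bq qm i p p r * Bq qm p r i p) = 1 := by
    obtain rfl | hip := hip.eq_or_lt
    · simp
    · rw [hA.Bq_diag hi hip (by omega), hA.Bq_adj hi hip hpr (by omega),
        mul_inv_cancel₀ hA.ne_zero]
  have hBC : Bq qm r j r j * (Bq qm p r r j * Bq qm r j p r) = 1 := by
    obtain rfl | hrj := hrj.eq_or_lt
    · simp
    · rw [hA.Bq_diag (by omega) hrj hj, hA.Bq_adj (by omega) hpr hrj hj,
        mul_inv_cancel₀ hA.ne_zero]
  have hAC := hA.Bq_far hi hpr hj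
  have hB := hA.Bq_diag (show 1 ≤ p by omega) hpr (by omega)
  have e₁ := Bq_mul_right qm i p hip hpr.le
  have e₂ := Bq_mul_left qm hpr.le hrj i r
  have e₃ := Bq_mul_left qm hpr.le hrj r j
  have e₄ := Bq_mul_right qm p r hip hpr.le
  have e₅ := Bq_mul_right qm r j hip hpr.le
  rw [← e₁, ← e₂, ← e₃, ← e₄, ← e₅]
  calc _ = (Bq qm i p i p * (Bq qm i p p r * Bq qm p r i p)) * Bq qm p r p r *
        (Bq qm i p r j * Bq qm r j i p) *
        (Bq qm r j r j * (Bq qm p r r j * Bq qm r j p r)) := by ring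
    _ = q := by rw [hAB, hB, hAC, hBC, one_mul, mul_one, mul_one]

/-- The summands of the coproduct of a root vector pairwise `q`-commute. -/
theorem IsSkewPrimitive.qcomm_summands (hG : IsSkewPrimitive qm g a n) (hA : IsTypeA qm n q)
    (hS : QSerre qm a n) (hq : q + 1 ≠ 0) {i p r j : ℕ} (hi : 1 ≤ i) (hip : i ≤ p)
    (hpr : p < r) (hrj : r ≤ j) (hj : j ≤ n + 1) :
    QComm q ((rootVec qm a i p * gp g p j) ⊗ₜ[k] rootVec qm a p j)
      ((rootVec qm a i r * gp g r j) ⊗ₜ[k] rootVec qm a r j) := by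
  have h₁ := hS.qcomm_rootVec_left hA hq hi hip hpr (hrj.trans hj)
  have h₂ : QComm (Bq qm i p r j) (rootVec qm a i p) (gp g r j) :=
    (hG.gp_qcomm_rootVec (p := r) (j := j) (i := i) (r := p) (by omega) hrj hj hi hip
      (by omega)).symm (by rw [mul_comm]; exact hA.Bq_far hi hpr hj)
  have h₃ := hG.gp_qcomm_rootVec (p := p) (j := j) (i := i) (r := r) (by omega) (by omega) hj hi
    (by omega) (by omega)
  have h₄ : QComm (1 : k) (gp g p j) (gp g r j) := by
    rw [QComm, one_smul]
    exact gp_commute (by omega) hrj fun l m _ _ _ _ =>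
      hG.comm l m (by omega) (by omega) (by omega) (by omega)
  have h := ((h₁.mul_right h₂).mul_left (h₃.mul_right h₄)).tmul
    (hS.qcomm_rootVec_right hA hq (by omega) hpr hrj hj)
  rwa [mul_one, hA.Bq_summands hi hip hpr hrj hj] at h

end Coproduct

/-- Lemma `comul-powrootvec` in bosonized form (Remark `ochopuntocuatro`, formula
(boson-deltapow)): `Δ(E_{i,j}^N) = E_{i,j}^N ⊗ 1 + g_{i,j}^N ⊗ E_{i,j}^N
 + (1 − q⁻¹)^N·Σ_{i<p<j} B(p,j;i,p)^{N(N−1)/2}·(E_{i,p}^N·g_{p,j}^N) ⊗ E_{p,j}^N`. -/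
theorem boson_deltapow {k H : Type*} [Field k] [Ring H] [HopfAlgebra k H]
    (n N : ℕ) (hn : 1 ≤ n) (hN : 2 < N) (q : k) (hq : IsPrimitiveRoot q N)
    (qm : ℕ → ℕ → k)
    (hqne : ∀ i j, 1 ≤ i → i ≤ n → 1 ≤ j → j ≤ n → qm i j ≠ 0)
    (hdiag : ∀ i, 1 ≤ i → i ≤ n → qm i i = q)
    (hadj : ∀ i j, 1 ≤ i → i ≤ n → 1 ≤ j → j ≤ n → (i = j + 1 ∨ j = i + 1) →
      qm i j * qm j i = q⁻¹)
    (hfar : ∀ i j, 1 ≤ i → i ≤ n → 1 ≤ j → j ≤ n → (i + 2 ≤ j ∨ j + 2 ≤ i) →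
      qm i j * qm j i = 1)
    (g a : ℕ → H)
    (hgunit : ∀ i, 1 ≤ i → i ≤ n → IsUnit (g i))
    (hgcomm : ∀ i j, 1 ≤ i → i ≤ n → 1 ≤ j → j ≤ n → g i * g j = g j * g i)
    (hglike : ∀ i, 1 ≤ i → i ≤ n →
      Coalgebra.comul (R := k) (g i) = g i ⊗ₜ[k] g i)
    (hgcounit : ∀ i, 1 ≤ i → i ≤ n → Coalgebra.counit (R := k) (g i) = 1)
    (hskew : ∀ i, 1 ≤ i → i ≤ n →
      Coalgebra.comul (R := k) (a i) = a i ⊗ₜ[k] 1 + g i ⊗ₜ[k] a i)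
    (hga : ∀ i j, 1 ≤ i → i ≤ n → 1 ≤ j → j ≤ n → g i * a j = qm i j • (a j * g i))
    (R1 : ∀ i p, 1 ≤ i → i < p → p ≤ n → i + 2 ≤ p →
      a i * a p = qm i p • (a p * a i))
    (R2 : ∀ i, 1 ≤ i → i < n →
      ee qm a i (i+1) * ee qm a i (i+2)
        = Bq qm i (i+1) i (i+2) • (ee qm a i (i+2) * ee qm a i (i+1)))
    (R3 : ∀ i, 1 ≤ i → i < n →
      ee qm a i (i+2) * ee qm a (i+1) (i+2)
        = Bq qm i (i+2) (i+1) (i+2) • (ee qm a (i+1) (i+2) * ee qm a i (i+2)))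
    : ∀ i j, 1 ≤ i → i < j → j ≤ n + 1 →
      Coalgebra.comul (R := k) (ee qm a i j ^ N)
        = (ee qm a i j ^ N) ⊗ₜ[k] (1 : H) + (gp g i j ^ N) ⊗ₜ[k] (ee qm a i j ^ N)
          + ((1 - q⁻¹) ^ N) • ∑ p ∈ Finset.Ioo i j,
              (Bq qm p j i p ^ (N * (N - 1) / 2)) •
                ((ee qm a i p ^ N * gp g p j ^ N) ⊗ₜ[k] (ee qm a p j ^ N)) := by
  have hA : IsTypeA qm n q :=
    { ne_zero := hq.ne_zero (by omega)
      diag := hdiag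
      adj := fun i h₁ h₂ => hadj i (i + 1) h₁ (by omega) (by omega) h₂ (Or.inr rfl)
      far := fun i j h₁ h₂ h₃ => hfar i j h₁ (by omega) (by omega) h₃ (Or.inl h₂) }
  have hS : QSerre qm a n :=
    { far := fun i p h₁ h₂ h₃ => R1 i p h₁ (by omega) h₃ h₂
      left := R2
      right := R3 }
  have hG : IsSkewPrimitive qm g a n :=
    { comm := hgcomm
      comul_a := hskew
      qcomm := hga }
  have hq1 : q + 1 ≠ 0 := fun h => by
    have h2 : q ^ 2 = 1 := by rw [eq_neg_of_add_eq_zero_left h, neg_one_sq]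
    exact hq.pow_ne_one_of_pos_of_lt two_ne_zero hN h2
  intro i j hi hij hj
  let c : ℕ → k := fun p => if p = i ∨ p = j then 1 else 1 - q⁻¹
  let T : ℕ → H ⊗[k] H := fun p => (rootVec qm a i p * gp g p j) ⊗ₜ[k] rootVec qm a p j
  have hIcc : Finset.Icc i j = insert i (insert j (Finset.Ioo i j)) := by ext; simp; omega
  have hcT : ∀ p ∈ Finset.Ioo i j,
      c p = 1 - q⁻¹ ∧ T p = (ee qm a i p * gp g p j) ⊗ₜ[k] ee qm a p j := fun p hp => by
    obtain ⟨h₁, h₂⟩ := Finset.mem_Ioo.1 hp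
    exact ⟨if_neg (by omega), by simp only [T, rootVec_of_lt h₁, rootVec_of_lt h₂]⟩
  have hsum : Coalgebra.comul (R := k) (ee qm a i j) = ∑ p ∈ Finset.Icc i j, c p • T p := by
    rw [hG.comul_ee hA hS hi hij hj, hIcc, Finset.sum_insert (by simp; omega),
      Finset.sum_insert (by simp), Finset.smul_sum,
      Finset.sum_congr rfl fun p hp => by rw [← (hcT p hp).1, ← (hcT p hp).2]]
    simp only [c, T, true_or, or_true, if_true, one_smul, rootVec_self, gp_self, one_mul, mul_one,
      rootVec_of_lt hij]
    abel
  rw [Bialgebra.comul_pow, hsum, QComm.sum_pow_of_isPrimitiveRoot hq (by omega)]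
  · rw [hIcc, Finset.sum_insert (by simp; omega), Finset.sum_insert (by simp), Finset.smul_sum]
    have hterm : ∀ p ∈ Finset.Ioo i j, (c p • T p) ^ N = (1 - q⁻¹) ^ N •
        Bq qm p j i p ^ (N * (N - 1) / 2) •
          ((ee qm a i p ^ N * gp g p j ^ N) ⊗ₜ[k] (ee qm a p j ^ N)) := fun p hp => by
      obtain ⟨h₁, h₂⟩ := Finset.mem_Ioo.1 hp
      rw [(hcT p hp).1, (hcT p hp).2, smul_pow, Algebra.TensorProduct.tmul_pow,
        (hG.gp_qcomm_ee (p := p) (j := j) (by omega) h₂.le hj hi h₁ (by omega)).mul_pow,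
        ← TensorProduct.smul_tmul']
    rw [Finset.sum_congr rfl hterm]
    simp only [c, T, true_or, or_true, if_true, one_smul, rootVec_self, gp_self, one_mul, mul_one,
      rootVec_of_lt hij, Algebra.TensorProduct.tmul_pow, one_pow]
    abel
  · intro p hp r hr hpr
    rw [Finset.mem_Icc] at hp hr
    exact ((hG.qcomm_summands hA hS hq1 hi hp.1 hpr hr.2 hj).smul_left _).smul_right _
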